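/- arXiv:cs/0607118 — 9 statements merged into one kernel-verified Lean document; each statement's English description precedes it below -/
import Mathlib

section
/- Let k ≥ 1, m ≥ 0, let y⃗ = (y_1,…,y_k), v⃗ = (v_1,…,v_k) be k-tuples and x⃗ = (x_1,…,x_m), u⃗ = (u_1,…,u_m) be m-tuples of natural numbers. If (v⃗,u⃗) ∈ 𝒫(y⃗,x⃗), then for every natural number d ≥ k+m we have ∑(d,v⃗,u⃗) < ∑(d,y⃗,x⃗). -/
/-- `v ≺ y` for `K`-tuples of natural numbers: there is a position `n` with
`y n ≠ 0`, `v` agrees with `y` before `n`, `v n = ⌊y n / 2⌋`, and after `n`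
each entry of `v` is some `y j` or some `⌊y j / 2⌋`. -/
def Prec {K : ℕ} (v y : Fin K → ℕ) : Prop :=
  ∃ n : Fin K, y n ≠ 0 ∧ (∀ i : Fin K, i < n → v i = y i) ∧ v n = y n / 2 ∧
    ∀ i : Fin K, n < i → ∃ j : Fin K, v i = y j ∨ v i = y j / 2

/-- `X = max(|y₁|,…,|y_k|,|x₁|,…,|x_m|) + 1` where `|·|` is the binary length. -/
def maxLen {k m : ℕ} (y : Fin k → ℕ) (x : Fin m → ℕ) : ℕ :=
  max (Finset.univ.sup fun i => Nat.size (y i))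
      (Finset.univ.sup fun i => Nat.size (x i)) + 1

/-- `∑(d, y⃗, x⃗) = Σ_{i=1}^k X^{d-i}·|y_i| + Σ_{i=1}^m X^{d-k-i}·|x_i|`. -/
def SumW {k m : ℕ} (d : ℕ) (y : Fin k → ℕ) (x : Fin m → ℕ) : ℕ :=
  (∑ i : Fin k, (maxLen y x) ^ (d - (i.val + 1)) * Nat.size (y i)) +
  ∑ i : Fin m, (maxLen y x) ^ (d - k - (i.val + 1)) * Nat.size (x i)

theorem sum_pow_mul_lt_pow {X K d : ℕ} (hX : 0 < X) (a : Fin K → ℕ) (ha : ∀ i, a i < X)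
    (hd : K ≤ d) : ∑ i : Fin K, X ^ (d - (i.val + 1)) * a i < X ^ d := by
  induction K generalizing d with
  | zero => simpa using pow_pos hX d
  | succ K ih =>
    obtain ⟨d, rfl⟩ : ∃ e, d = e + 1 := ⟨d - 1, by omega⟩
    have h := ih (fun i => a i.succ) (fun i => ha _) (d := d) (by omega)
    rw [Fin.sum_univ_succ]
    simp only [Fin.val_zero, Fin.val_succ, zero_add, Nat.add_sub_cancel, Nat.add_sub_add_right]
    calc X ^ d * a 0 + ∑ i : Fin K, X ^ (d - (i.val + 1)) * a i.succ
        < X ^ d * a 0 + X ^ d := by omega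
      _ = X ^ d * (a 0 + 1) := by ring
      _ ≤ X ^ d * X := Nat.mul_le_mul_left _ (ha 0)
      _ = X ^ (d + 1) := (pow_succ _ _).symm

/-- Lexicographic order of digit strings implies the order of the numbers they represent. -/
theorem sum_pow_mul_lt_sum_of_lex {X K d : ℕ} (hX : 0 < X) (a b : Fin K → ℕ)
    (ha : ∀ i, a i < X) (hd : K ≤ d) (n : Fin K) (heq : ∀ i < n, a i = b i)
    (hlt : a n < b n) :
    ∑ i : Fin K, X ^ (d - (i.val + 1)) * a i < ∑ i : Fin K, X ^ (d - (i.val + 1)) * b i := by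
  induction K generalizing d with
  | zero => exact n.elim0
  | succ K ih =>
    obtain ⟨d, rfl⟩ : ∃ e, d = e + 1 := ⟨d - 1, by omega⟩
    rw [Fin.sum_univ_succ, Fin.sum_univ_succ]
    simp only [Fin.val_zero, Fin.val_succ, zero_add, Nat.add_sub_cancel, Nat.add_sub_add_right]
    cases n using Fin.cases with
    | zero =>
      have h := sum_pow_mul_lt_pow hX (fun i => a i.succ) (fun i => ha _) (d := d) (by omega)
      have h' : X ^ d * (a 0 + 1) ≤ X ^ d * b 0 := Nat.mul_le_mul_left _ hlt
      rw [mul_add, mul_one] at h'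
      omega
    | succ n =>
      have h := ih (fun i => a i.succ) (fun i => b i.succ) (fun i => ha _) (d := d) (by omega) n
        (fun i hi => heq _ (Fin.succ_lt_succ_iff.mpr hi)) hlt
      rw [heq 0 (Fin.succ_pos n)]
      omega

theorem sumW_eq_sum_append {k m : ℕ} (d : ℕ) (y : Fin k → ℕ) (x : Fin m → ℕ) :
    SumW d y x =
      ∑ i : Fin (k + m), maxLen y x ^ (d - (i.val + 1)) * Nat.size (Fin.append y x i) := by
  simp only [SumW, Fin.sum_univ_add, Fin.append_left, Fin.append_right, Fin.val_castAdd,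
    Fin.val_natAdd, Nat.sub_sub, add_assoc]

theorem size_append_lt_maxLen {k m : ℕ} (y : Fin k → ℕ) (x : Fin m → ℕ) (i : Fin (k + m)) :
    Nat.size (Fin.append y x i) < maxLen y x := by
  refine Nat.lt_succ_of_le ?_
  cases i using Fin.addCases with
  | left i =>
    rw [Fin.append_left]
    exact le_max_of_le_left (Finset.le_sup (f := fun i => Nat.size (y i)) (Finset.mem_univ i))
  | right i =>
    rw [Fin.append_right]
    exact le_max_of_le_right (Finset.le_sup (f := fun i => Nat.size (x i)) (Finset.mem_univ i))

theorem maxLen_le_of_size_append_lt {k m X : ℕ} (hX : 0 < X) (v : Fin k → ℕ) (u : Fin m → ℕ)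
    (h : ∀ i, Nat.size (Fin.append v u i) < X) : maxLen v u ≤ X := by
  refine Nat.succ_le_of_lt (max_lt ?_ ?_)
  · exact (Finset.sup_lt_iff hX).mpr fun i _ => by simpa using h (Fin.castAdd m i)
  · exact (Finset.sup_lt_iff hX).mpr fun i _ => by simpa using h (Fin.natAdd k i)

theorem Nat.size_half_lt_size {n : ℕ} (hn : n ≠ 0) : Nat.size (n / 2) < Nat.size n := by
  have h : 0 < Nat.size n := Nat.size_pos.mpr (Nat.pos_of_ne_zero hn)
  have h' : n < 2 ^ Nat.size n := Nat.lt_size_self n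
  obtain ⟨s, hs⟩ : ∃ s, Nat.size n = s + 1 := ⟨Nat.size n - 1, by omega⟩
  rw [hs, pow_succ] at h'
  rw [hs, Nat.lt_succ_iff, Nat.size_le]
  omega

theorem Prec.exists_eq_or_eq_half {K : ℕ} {v y : Fin K → ℕ} (h : Prec v y) (i : Fin K) :
    ∃ j, v i = y j ∨ v i = y j / 2 := by
  obtain ⟨n, -, hlt, hn, hgt⟩ := h
  rcases lt_trichotomy i n with hi | rfl | hi
  · exact ⟨i, Or.inl (hlt i hi)⟩
  · exact ⟨i, Or.inr hn⟩
  · exact hgt i hi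

theorem stmt0 {k m : ℕ} (hk : 1 ≤ k) (y v : Fin k → ℕ) (x u : Fin m → ℕ)
    (hP : Prec (Fin.append v u) (Fin.append y x) ∧ Prec v y)
    {d : ℕ} (hd : k + m ≤ d) :
    SumW d v u < SumW d y x := by
  have hX : 0 < maxLen y x := Nat.succ_pos _
  have hsize : ∀ i, Nat.size (Fin.append v u i) < maxLen y x := fun i => by
    obtain ⟨j, hj | hj⟩ := hP.1.exists_eq_or_eq_half i
    · exact hj ▸ size_append_lt_maxLen y x j
    · exact hj ▸ (Nat.size_le_size (Nat.div_le_self _ 2)).trans_lt (size_append_lt_maxLen y x j)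
  obtain ⟨n, hn0, heq, hn, -⟩ := hP.1
  rw [sumW_eq_sum_append, sumW_eq_sum_append]
  calc ∑ i : Fin (k + m), maxLen v u ^ (d - (i.val + 1)) * Nat.size (Fin.append v u i)
      ≤ ∑ i : Fin (k + m), maxLen y x ^ (d - (i.val + 1)) * Nat.size (Fin.append v u i) :=
        Finset.sum_le_sum fun i _ => Nat.mul_le_mul_right _
          (Nat.pow_le_pow_left (maxLen_le_of_size_append_lt hX v u hsize) _)
    _ < ∑ i : Fin (k + m), maxLen y x ^ (d - (i.val + 1)) * Nat.size (Fin.append y x i) :=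
        sum_pow_mul_lt_sum_of_lex hX _ _ hsize hd n
          (fun i hi => congrArg Nat.size (heq i hi)) (hn ▸ Nat.size_half_lt_size hn0)
end

section
/- Let π : ℕ × ℕ × ℕ → ℕ satisfy π(0,a,b) = 0 and, for all y,a,b ∈ ℕ and i ∈ {0,1} with 2y+i ≠ 0, π(2y+i, a, b) = 4·π(y,a,b) + 2·bit_{|y|}(a) + bit_{|y|}(b). Then for all y,a,b ∈ ℕ: π(y,a,b) = Σ_{j<|y|} (2·bit_j(a) + bit_j(b))·4^{|y|-1-j}. In particular, if a and b have binary representations a = (a_{n-1}⋯a_0)₂ and b = (b_{m-1}⋯b_0)₂, then π(y,a,b) = (a_0 b_0 ⋯ a_{|y|-1} b_{|y|-1})₂, the interleaving in reverse order of the |y| low-order bits of a and b. -/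
/-- `bit j a` is the `j`-th binary digit of `a`. -/
def bit (j a : ℕ) : ℕ := a / 2 ^ j % 2

theorem Nat.size_two_mul_add {y i : ℕ} (hi : i ≤ 1) (h : 2 * y + i ≠ 0) :
    Nat.size (2 * y + i) = Nat.size y + 1 := by
  have key (b : Bool) (hb : Nat.bit b y ≠ 0) := Nat.size_bit hb
  interval_cases i
  · simpa [Nat.bit_val] using key false (by simpa [Nat.bit_val] using h)
  · simpa [Nat.bit_val] using key true (by simp [Nat.bit_val])

theorem Finset.sum_range_succ_mul_pow_reverse (f : ℕ → ℕ) (c n : ℕ) :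
    ∑ j ∈ Finset.range (n + 1), f j * c ^ (n + 1 - 1 - j) =
      c * ∑ j ∈ Finset.range n, f j * c ^ (n - 1 - j) + f n := by
  rw [Finset.sum_range_succ, Finset.mul_sum]
  congr 1
  · refine Finset.sum_congr rfl fun j hj => ?_
    have hj : j < n := Finset.mem_range.mp hj
    rw [show n + 1 - 1 - j = n - 1 - j + 1 by omega, pow_succ]
    ring
  · simp

theorem stmt1 (π : ℕ → ℕ → ℕ → ℕ)
    (h0 : ∀ a b, π 0 a b = 0)
    (hs : ∀ y a b i, i ≤ 1 → 2 * y + i ≠ 0 →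
      π (2 * y + i) a b =
        4 * π y a b + 2 * bit (Nat.size y) a + bit (Nat.size y) b) :
    ∀ y a b, π y a b =
      ∑ j ∈ Finset.range (Nat.size y),
        (2 * bit j a + bit j b) * 4 ^ (Nat.size y - 1 - j) := by
  intro y a b
  induction y using Nat.strong_induction_on with
  | _ y ih =>
    rcases Nat.eq_zero_or_pos y with rfl | hy
    · simp [h0]
    · obtain ⟨z, i, hi, rfl⟩ : ∃ z i, i ≤ 1 ∧ y = 2 * z + i :=
        ⟨y / 2, y % 2, by omega, by omega⟩
      rw [hs z a b i hi hy.ne', Nat.size_two_mul_add hi hy.ne',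
        Finset.sum_range_succ_mul_pow_reverse (fun j => 2 * bit j a + bit j b),
        ih z (by omega), add_assoc]
end

section
/- Let M : ℕ × ℕ → ℕ satisfy M(0,a) = ⌊a/2⌋ and, for all y,a ∈ ℕ and i ∈ {0,1} with 2y+i ≠ 0, M(2y+i, a) = M(y, M(y, a)). Then for all y,a ∈ ℕ: M(y,a) = ⌊a / 2^{2^{|y|}}⌋, i.e. M(y,a) is the 2^{|y|}-th iterated binary predecessor of a. -/
/-- Halving a positive number drops exactly one binary digit. -/
theorem Nat.size_eq_size_div_two_add_one {y : ℕ} (hy : y ≠ 0) :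
    Nat.size y = Nat.size (y / 2) + 1 := by
  have h : Nat.bit y.bodd y.div2 = y := Nat.bit_bodd_div2 y
  have hsize := Nat.size_bit (b := y.bodd) (n := y.div2) (by rwa [h])
  rwa [h, Nat.div2_val] at hsize

theorem stmt2 (M : ℕ → ℕ → ℕ)
    (h0 : ∀ a, M 0 a = a / 2)
    (hs : ∀ y a i, i ≤ 1 → 2 * y + i ≠ 0 → M (2 * y + i) a = M y (M y a)) :
    ∀ y a, M y a = a / 2 ^ 2 ^ Nat.size y := by
  intro y
  induction y using Nat.strong_induction_on with
  | _ y ih =>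
    intro a
    rcases eq_or_ne y 0 with rfl | hy
    · simp [h0]
    · have hdiv : 2 * (y / 2) + y % 2 = y := Nat.div_add_mod y 2
      have hrec := hs (y / 2) a (y % 2) (by omega) (by omega)
      have hlt : y / 2 < y := by omega
      rw [hdiv] at hrec
      rw [hrec, ih _ hlt, ih _ hlt, Nat.div_div_eq_div_mul, ← pow_add, ← two_mul, ← pow_succ',
        ← Nat.size_eq_size_div_two_add_one hy]
end

section
/- Let A : ℕ × ℕ → ℕ satisfy A(0,a) = 2a+1 and, for all y,a ∈ ℕ and i ∈ {0,1} with 2y+i ≠ 0, A(2y+i, a) = A(y, A(y, a)). Then for all y,a ∈ ℕ: A(y,a) = (a+1)·2^{2^{|y|}} − 1, i.e. A(y,a) is the 2^{|y|}-th iterate of the successor a ↦ 2a+1 (the addition of 2^{|y|} in unary notation) applied to a. -/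
theorem stmt3 (A : ℕ → ℕ → ℕ)
    (h0 : ∀ a, A 0 a = 2 * a + 1)
    (hs : ∀ y a i, i ≤ 1 → 2 * y + i ≠ 0 → A (2 * y + i) a = A y (A y a)) :
    ∀ y a, A y a = (a + 1) * 2 ^ 2 ^ Nat.size y - 1 := by
  suffices h : ∀ y a, A y a + 1 = (a + 1) * 2 ^ 2 ^ Nat.size y from
    fun y a => Nat.eq_sub_of_add_eq (h y a)
  intro y
  induction y using Nat.binaryRec with
  | zero =>
    intro a
    simp only [h0, Nat.size_zero, pow_zero, pow_one]
    ring
  | bit b n ih =>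
    intro a
    by_cases hb : Nat.bit b n = 0
    · rw [hb, h0, Nat.size_zero, pow_zero, pow_one]
      ring
    · have hA : A (Nat.bit b n) a = A n (A n a) := by
        rw [Nat.bit_val] at hb ⊢
        exact hs n a b.toNat (Bool.toNat_le b) hb
      rw [hA, ih, ih, Nat.size_bit hb, pow_succ 2 n.size, pow_mul, sq, mul_assoc]
end

section
/- Let f : ℕ⁷ → ℕ satisfy, for all x,y,z,u,v,w,a ∈ ℕ and i ∈ {0,1}: f(0,0,0,0,0,0,a) = 2a; f(x,y,z,u,v,2w+i,a) = f(x,y,z,u,v,w, f(x,y,z,u,v,w,a)) whenever 2w+i ≠ 0; f(x,y,z,u,2v+i,0,a) = f(x,y,z,u,v,u,a) whenever 2v+i ≠ 0; f(x,y,2z+i,u,0,0,a) = f(x,y,z,x,y,0,a) whenever 2z+i ≠ 0; f(x,2y+i,0,u,0,0,a) = f(x,y,0,u,0,0,a) whenever 2y+i ≠ 0; f(2x+i,0,0,u,0,0,a) = f(x,0,0,u,0,0,a) whenever 2x+i ≠ 0; and f(0,0,0,2u+i,0,0,a) = f(0,0,0,u,0,0,a) whenever 2u+i ≠ 0. Then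 for all x,y,z,u,v,w,a ∈ ℕ: f(x,y,z,u,v,w,a) = 2^{2^{|x|·|y|·|z| + |u|·|v| + |w|}}·a. -/
/-- Induction on binary digits, exposing the length of the successor `2 * n + i`. -/
theorem Nat.induction_on_binary_length {P : ℕ → Prop} (zero : P 0)
    (step : ∀ n i, i ≤ 1 → 2 * n + i ≠ 0 → Nat.size (2 * n + i) = Nat.size n + 1 →
      P n → P (2 * n + i)) (n : ℕ) : P n := by
  induction n using Nat.strong_induction_on with
  | _ n ih =>
    rcases Nat.eq_zero_or_pos n with rfl | hn
    · exact zero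
    · have hd : 2 * (n / 2) + n % 2 = n := Nat.div_add_mod n 2
      have hsize : Nat.size n = Nat.size (n / 2) + 1 := by
        have h := Nat.size_bit (b := n.bodd) (n := n.div2) (by rw [Nat.bit_bodd_div2]; omega)
        rwa [Nat.bit_bodd_div2, Nat.div2_val] at h
      have h := step (n / 2) (n % 2) (by omega) (by omega) (by rw [hd, hsize])
        (ih (n / 2) (by omega))
      rwa [hd] at h

theorem stmt6 (f : ℕ → ℕ → ℕ → ℕ → ℕ → ℕ → ℕ → ℕ)
    (h0 : ∀ a, f 0 0 0 0 0 0 a = 2 * a)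
    (h1 : ∀ x y z u v w a i, i ≤ 1 → 2 * w + i ≠ 0 →
      f x y z u v (2 * w + i) a = f x y z u v w (f x y z u v w a))
    (h2 : ∀ x y z u v a i, i ≤ 1 → 2 * v + i ≠ 0 →
      f x y z u (2 * v + i) 0 a = f x y z u v u a)
    (h3 : ∀ x y z u a i, i ≤ 1 → 2 * z + i ≠ 0 →
      f x y (2 * z + i) u 0 0 a = f x y z x y 0 a)
    (h4 : ∀ x y u a i, i ≤ 1 → 2 * y + i ≠ 0 →
      f x (2 * y + i) 0 u 0 0 a = f x y 0 u 0 0 a)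
    (h5 : ∀ x u a i, i ≤ 1 → 2 * x + i ≠ 0 →
      f (2 * x + i) 0 0 u 0 0 a = f x 0 0 u 0 0 a)
    (h6 : ∀ u a i, i ≤ 1 → 2 * u + i ≠ 0 →
      f 0 0 0 (2 * u + i) 0 0 a = f 0 0 0 u 0 0 a) :
    ∀ x y z u v w a, f x y z u v w a =
      2 ^ 2 ^ (Nat.size x * Nat.size y * Nat.size z +
               Nat.size u * Nat.size v + Nat.size w) * a := by
  have extend_w : ∀ x y z u v k, (∀ a, f x y z u v 0 a = 2 ^ 2 ^ k * a) →
      ∀ w a, f x y z u v w a = 2 ^ 2 ^ (k + Nat.size w) * a := by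
    intro x y z u v k hk w
    induction w using Nat.induction_on_binary_length with
    | zero => simpa using hk
    | step w i hi hne hsize ih =>
      intro a
      rw [h1 x y z u v w a i hi hne, ih, ih, hsize, ← mul_assoc, ← pow_add, ← add_assoc,
        pow_succ 2 (k + Nat.size w), mul_two]
  have extend_v : ∀ x y z u k, (∀ a, f x y z u 0 0 a = 2 ^ 2 ^ k * a) →
      ∀ v a, f x y z u v 0 a = 2 ^ 2 ^ (k + Nat.size u * Nat.size v) * a := by
    intro x y z u k hk v
    induction v using Nat.induction_on_binary_length with
    | zero => simpa using hk
    | step v i hi hne hsize ih =>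
      intro a
      rw [h2 x y z u v a i hi hne, extend_w x y z u v _ ih, hsize, mul_add_one, add_assoc]
  have base_u : ∀ u a, f 0 0 0 u 0 0 a = 2 * a := by
    intro u
    induction u using Nat.induction_on_binary_length with
    | zero => exact h0
    | step u i hi hne _ ih => exact fun a => (h6 u a i hi hne).trans (ih a)
  have base_x : ∀ x u a, f x 0 0 u 0 0 a = 2 * a := by
    intro x
    induction x using Nat.induction_on_binary_length with
    | zero => exact base_u
    | step x i hi hne _ ih => exact fun u a => (h5 x u a i hi hne).trans (ih u a)
  have base_y : ∀ x y u a, f x y 0 u 0 0 a = 2 * a := by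
    intro x y
    induction y using Nat.induction_on_binary_length with
    | zero => exact base_x x
    | step y i hi hne _ ih => exact fun u a => (h4 x y u a i hi hne).trans (ih u a)
  have base_z : ∀ x y z u a,
      f x y z u 0 0 a = 2 ^ 2 ^ (Nat.size x * Nat.size y * Nat.size z) * a := by
    intro x y z
    induction z using Nat.induction_on_binary_length with
    | zero => simpa using base_y x y
    | step z i hi hne hsize ih =>
      intro u a
      rw [h3 x y z u a i hi hne, extend_v x y z x _ (ih x), hsize, mul_add_one]
  intro x y z u v w a
  exact extend_w x y z u v _ (extend_v x y z u _ (base_z x y z u) v) w a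
end

section
/- Let U₁, U₂ : ℕ³ → ℕ satisfy U₁(0,a,c) = 2c + bit_1(a), U₂(0,a,c) = 2c + bit_0(a), and, for j ∈ {1,2}, all y,a,c ∈ ℕ and i ∈ {0,1} with 2y+i ≠ 0, writing N = 2^{|y|}: U_j(2y+i, a, c) = U_j(y, ⌊a/2^{2N}⌋, U_j(y, a mod 2^{2N}, c)). Then for all y,a,c ∈ ℕ, with N = 2^{|y|}: U₁(y,a,c) = c·2^N + Σ_{j<N} bit_{2j+1}(a)·2^{N-1-j} and U₂(y,a,c) = c·2^N + Σ_{j<N} bit_{2j}(a)·2^{N-1-j}; that is, U₁ (resp. U₂) extracts the odd-position (resp. even-position) bits among the 2N low-order bits of a, in reverse order, concatenated to c. -/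
theorem bit_mod_two_pow {j m : ℕ} (h : j < m) (a : ℕ) : bit j (a % 2 ^ m) = bit j a := by
  have h_test := congrArg Bool.toNat (Nat.testBit_mod_two_pow a m j)
  rwa [decide_eq_true h, Bool.true_and, Nat.toNat_testBit, Nat.toNat_testBit] at h_test

theorem bit_div_two_pow (j m a : ℕ) : bit j (a / 2 ^ m) = bit (m + j) a := by
  simp only [bit, Nat.div_div_eq_div_mul, pow_add]

/-- Nested recursion on notation that halves the block of `2 * 2 ^ Nat.size y` low-order bits
collects the bits in the positions congruent to `e` modulo `2`, in reverse order. -/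
theorem nested_recursion_eq_sum_bit {e : ℕ} (he : e ≤ 1) (U : ℕ → ℕ → ℕ → ℕ)
    (h0 : ∀ a c, U 0 a c = 2 * c + bit e a)
    (hs : ∀ y a c i, i ≤ 1 → 2 * y + i ≠ 0 →
      U (2 * y + i) a c =
        U y (a / 2 ^ (2 * 2 ^ Nat.size y)) (U y (a % 2 ^ (2 * 2 ^ Nat.size y)) c))
    (y a c : ℕ) :
    U y a c = c * 2 ^ 2 ^ Nat.size y +
      ∑ j ∈ Finset.range (2 ^ Nat.size y),
        bit (2 * j + e) a * 2 ^ (2 ^ Nat.size y - 1 - j) := by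
  induction y using Nat.strong_induction_on generalizing a c with
  | _ z ih =>
    rcases Nat.eq_zero_or_pos z with rfl | hz
    · simp [h0, mul_comm]
    · have h_size : Nat.size z = Nat.size (z / 2) + 1 := by
        have h := Nat.size_bit (b := z.bodd) (n := z.div2) (by rw [Nat.bit_bodd_div2]; omega)
        rwa [Nat.bit_bodd_div2, Nat.div2_val] at h
      have h_step := hs (z / 2) a c (z % 2) (by omega) (by omega)
      rw [Nat.div_add_mod] at h_step
      rw [h_step, ih _ (by omega), ih _ (by omega), h_size, pow_succ, mul_two]
      set N := 2 ^ Nat.size (z / 2)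
      rw [Finset.sum_range_add, add_mul, Finset.sum_mul, pow_add, mul_assoc, add_assoc]
      congr 2
      · refine Finset.sum_congr rfl fun j hj => ?_
        rw [Finset.mem_range] at hj
        rw [bit_mod_two_pow (by omega), mul_assoc, ← pow_add]
        congr 2
        omega
      · refine Finset.sum_congr rfl fun j _ => ?_
        rw [bit_div_two_pow]
        congr 2 <;> omega

theorem stmt11 (U₁ U₂ : ℕ → ℕ → ℕ → ℕ)
    (h10 : ∀ a c, U₁ 0 a c = 2 * c + bit 1 a)
    (h20 : ∀ a c, U₂ 0 a c = 2 * c + bit 0 a)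
    (h1s : ∀ y a c i, i ≤ 1 → 2 * y + i ≠ 0 →
      U₁ (2 * y + i) a c =
        U₁ y (a / 2 ^ (2 * 2 ^ Nat.size y)) (U₁ y (a % 2 ^ (2 * 2 ^ Nat.size y)) c))
    (h2s : ∀ y a c i, i ≤ 1 → 2 * y + i ≠ 0 →
      U₂ (2 * y + i) a c =
        U₂ y (a / 2 ^ (2 * 2 ^ Nat.size y)) (U₂ y (a % 2 ^ (2 * 2 ^ Nat.size y)) c)) :
    ∀ y a c,
      U₁ y a c = c * 2 ^ 2 ^ Nat.size y +
        ∑ j ∈ Finset.range (2 ^ Nat.size y),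
          bit (2 * j + 1) a * 2 ^ (2 ^ Nat.size y - 1 - j) ∧
      U₂ y a c = c * 2 ^ 2 ^ Nat.size y +
        ∑ j ∈ Finset.range (2 ^ Nat.size y),
          bit (2 * j) a * 2 ^ (2 ^ Nat.size y - 1 - j) := by
  exact fun y a c => ⟨nested_recursion_eq_sum_bit le_rfl U₁ h10 h1s y a c,
    nested_recursion_eq_sum_bit zero_le_one U₂ h20 h2s y a c⟩
end

section
/- For N ∈ ℕ define the pairing P(N,a,b,d) := d·4^N + Σ_{j<N} (2·bit_j(a) + bit_j(b))·4^{N-1-j} and the unpairings U¹(N,e) := Σ_{j<N} bit_{2j+1}(e)·2^{N-1-j} and U²(N,e) := Σ_{j<N} bit_{2j}(e)·2^{N-1-j}. Then for all N, d ∈ ℕ and all a, b < 2^N: U¹(N, P(N,a,b,d)) = a and U²(N, P(N,a,b,d)) = b; i.e. unpairing recovers both components of the pair ⟨a,b⟩ = P(N,a,b,d), regardless of the higher-order garbage d. -/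
/-- The high-speed pairing: `d` concatenated with the reversed interleaving of the
`N` low-order bits of `a` and `b`. -/
def pairP (N a b d : ℕ) : ℕ :=
  d * 4 ^ N + ∑ j ∈ Finset.range N, (2 * bit j a + bit j b) * 4 ^ (N - 1 - j)

/-- First unpairing: the odd-position bits among the `2N` low-order bits, reversed. -/
def unpair₁ (N e : ℕ) : ℕ := ∑ j ∈ Finset.range N, bit (2 * j + 1) e * 2 ^ (N - 1 - j)

/-- Second unpairing: the even-position bits among the `2N` low-order bits, reversed. -/
def unpair₂ (N e : ℕ) : ℕ := ∑ j ∈ Finset.range N, bit (2 * j) e * 2 ^ (N - 1 - j)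

theorem bit_lt_two (j a : ℕ) : bit j a < 2 := Nat.mod_lt _ two_pos

theorem sum_bit_mul_two_pow (N a : ℕ) :
    ∑ j ∈ Finset.range N, bit j a * 2 ^ j = a % 2 ^ N := by
  induction N with
  | zero => simp [Nat.mod_one]
  | succ N ih => rw [Finset.sum_range_succ, ih, Nat.mod_pow_succ, bit, mul_comm]

theorem digit_add_sum {B : ℕ} (d : ℕ) {N i : ℕ} (c : ℕ → ℕ) (hc : ∀ j, c j < B)
    (hi : i < N) : (d * B ^ N + ∑ j ∈ Finset.range N, c j * B ^ j) / B ^ i % B = c i := by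
  have hB : 0 < B := (Nat.zero_le _).trans_lt (hc 0)
  induction N generalizing c i with
  | zero => omega
  | succ N ih =>
    have split : d * B ^ (N + 1) + ∑ j ∈ Finset.range (N + 1), c j * B ^ j
        = c 0 + B * (d * B ^ N + ∑ j ∈ Finset.range N, c (j + 1) * B ^ j) := by
      rw [Finset.sum_range_succ', mul_add, Finset.mul_sum]
      simp only [pow_succ, pow_zero, mul_one]
      rw [Finset.sum_congr rfl fun j _ =>
        show c (j + 1) * (B ^ j * B) = B * (c (j + 1) * B ^ j) by ring]
      ring
    rw [split]
    cases i with
    | zero => simp [Nat.mod_eq_of_lt (hc 0)]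
    | succ i =>
      rw [pow_succ', ← Nat.div_div_eq_div_mul, Nat.add_mul_div_left _ _ hB,
        Nat.div_eq_of_lt (hc 0), zero_add]
      exact ih (fun j => c (j + 1)) (fun j => hc (j + 1)) (by omega)

theorem pairP_digit (a b d : ℕ) {N j : ℕ} (hj : j < N) :
    pairP N a b d / 4 ^ j % 4 = 2 * bit (N - 1 - j) a + bit (N - 1 - j) b := by
  have reflect : ∑ i ∈ Finset.range N, (2 * bit i a + bit i b) * 4 ^ (N - 1 - i)
      = ∑ i ∈ Finset.range N, (2 * bit (N - 1 - i) a + bit (N - 1 - i) b) * 4 ^ i := by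
    rw [← Finset.sum_range_reflect]
    refine Finset.sum_congr rfl fun i hi => ?_
    rw [Nat.sub_sub_self (Nat.le_sub_one_of_lt (Finset.mem_range.mp hi))]
  rw [pairP, reflect]
  refine digit_add_sum d (fun i => 2 * bit (N - 1 - i) a + bit (N - 1 - i) b) (fun i => ?_) hj
  have := bit_lt_two (N - 1 - i) a
  have := bit_lt_two (N - 1 - i) b
  omega

theorem bit_two_mul_add_one (j e : ℕ) : bit (2 * j + 1) e = e / 4 ^ j % 4 / 2 := by
  rw [bit, pow_succ, pow_mul, ← Nat.div_div_eq_div_mul]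
  norm_num only
  omega

theorem bit_two_mul (j e : ℕ) : bit (2 * j) e = e / 4 ^ j % 4 % 2 := by
  rw [bit, pow_mul]
  norm_num only
  omega

theorem unpair₁_pairP (N a b d : ℕ) : unpair₁ N (pairP N a b d) = a % 2 ^ N := by
  rw [unpair₁, ← sum_bit_mul_two_pow, ← Finset.sum_range_reflect (fun j => bit j a * 2 ^ j)]
  refine Finset.sum_congr rfl fun j hj => ?_
  rw [bit_two_mul_add_one, pairP_digit a b d (Finset.mem_range.mp hj)]
  have := bit_lt_two (N - 1 - j) b
  congr 1
  omega

theorem unpair₂_pairP (N a b d : ℕ) : unpair₂ N (pairP N a b d) = b % 2 ^ N := by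
  rw [unpair₂, ← sum_bit_mul_two_pow, ← Finset.sum_range_reflect (fun j => bit j b * 2 ^ j)]
  refine Finset.sum_congr rfl fun j hj => ?_
  rw [bit_two_mul, pairP_digit a b d (Finset.mem_range.mp hj)]
  have := bit_lt_two (N - 1 - j) b
  congr 1
  omega

theorem stmt12 (N d a b : ℕ) (ha : a < 2 ^ N) (hb : b < 2 ^ N) :
    unpair₁ N (pairP N a b d) = a ∧ unpair₂ N (pairP N a b d) = b := by
  rw [unpair₁_pairP, unpair₂_pairP]
  exact ⟨Nat.mod_eq_of_lt ha, Nat.mod_eq_of_lt hb⟩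
end

section
/- Let X be an arbitrary type, l ≥ 1, and let f : Fin l → ℕ → X → ℕ and h : Fin l → X → (Fin l → ℕ) → ℕ satisfy: for every j, every y ∈ ℕ, every i ∈ {0,1} with 2y+i ≠ 0, and every x ∈ X, f j (2y+i) x = h j x (λ j'. f j' y x). Let F : Fin l → ℕ → X → (Fin l → ℕ) → ℕ satisfy F j 0 x a⃗ = h j x a⃗ and, for 2y+i ≠ 0, F j (2y+i) x a⃗ = F j y x (λ j'. F j' y x a⃗). Then for all j, all y, z ∈ ℕ and all x ∈ X: F j y x (λ j'. f j' z x) = f j ((z+1)·2^{2^{|y|}} − 1) x. -/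
theorem stmt13 {X : Type*} {l : ℕ} (hl : 1 ≤ l)
    (f : Fin l → ℕ → X → ℕ) (h : Fin l → X → (Fin l → ℕ) → ℕ)
    (hf : ∀ (j : Fin l) (y i : ℕ) (x : X), i ≤ 1 → 2 * y + i ≠ 0 →
      f j (2 * y + i) x = h j x (fun j' => f j' y x))
    (F : Fin l → ℕ → X → (Fin l → ℕ) → ℕ)
    (hF0 : ∀ (j : Fin l) (x : X) (a : Fin l → ℕ), F j 0 x a = h j x a)
    (hFs : ∀ (j : Fin l) (y i : ℕ) (x : X) (a : Fin l → ℕ), i ≤ 1 → 2 * y + i ≠ 0 →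
      F j (2 * y + i) x a = F j y x (fun j' => F j' y x a)) :
    ∀ (j : Fin l) (y z : ℕ) (x : X),
      F j y x (fun j' => f j' z x) = f j ((z + 1) * 2 ^ 2 ^ Nat.size y - 1) x := by
  intro j y
  induction y using Nat.strong_induction_on generalizing j with
  | _ y ih =>
    intro z x
    rcases Nat.eq_zero_or_pos y with rfl | hy
    · have hz : (z + 1) * 2 ^ 2 ^ Nat.size 0 - 1 = 2 * z + 1 := by
        rw [Nat.size_zero, pow_zero, pow_one]
        omega
      rw [hF0, hz, hf j z 1 x le_rfl (by omega)]
    · have hlt : y / 2 < y := by omega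
      have hy2 : 2 * (y / 2) + y % 2 = y := by omega
      have hsize : Nat.size y = Nat.size (y / 2) + 1 := by
        have hbit : Nat.bit (Nat.bodd y) (y / 2) = y := by
          rw [← Nat.div2_val, Nat.bit_bodd_div2]
        have hs := Nat.size_bit (b := Nat.bodd y) (n := y / 2) (by omega)
        rwa [hbit] at hs
      have hstep := hFs j (y / 2) (y % 2) x (fun j' => f j' z x) (by omega) (by omega)
      rw [hy2] at hstep
      have hinner : (fun j' => F j' (y / 2) x (fun j' => f j' z x)) =
          fun j' => f j' ((z + 1) * 2 ^ 2 ^ Nat.size (y / 2) - 1) x :=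
        funext fun j' => ih _ hlt j' z x
      rw [hstep, hinner, ih _ hlt, hsize,
        Nat.sub_add_cancel (Nat.mul_pos z.succ_pos (by positivity)), mul_assoc, ← pow_add,
        pow_succ 2 (Nat.size (y / 2)), mul_two]
end

section
/- Let X be an arbitrary type, l ≥ 1, and let g : Fin l → X → ℕ, f : Fin l → ℕ → X → ℕ and h : Fin l → X → (Fin l → ℕ) → ℕ satisfy: f j 0 x = g j x for all j, x, and f j (2y+i) x = h j x (λ j'. f j' y x) for every j, every y ∈ ℕ, every i ∈ {0,1} with 2y+i ≠ 0, and every x ∈ X. Let F : Fin l → ℕ → X → (Fin l → ℕ) → ℕ satisfy F j 0 x a⃗ = h j x a⃗ and, for 2y+i ≠ 0, F j (2y+i) x a⃗ = F j y x (λ j'. F j' y x a⃗). Then for all j, all y ∈ ℕ and all x ∈ X: F j y x (λ j'. g j' x) = f j (2^{2^{|y|}} − 1) x. -/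
theorem stmt14 {X : Type*} {l : ℕ} (hl : 1 ≤ l)
    (g : Fin l → X → ℕ) (f : Fin l → ℕ → X → ℕ) (h : Fin l → X → (Fin l → ℕ) → ℕ)
    (hf0 : ∀ (j : Fin l) (x : X), f j 0 x = g j x)
    (hfs : ∀ (j : Fin l) (y i : ℕ) (x : X), i ≤ 1 → 2 * y + i ≠ 0 →
      f j (2 * y + i) x = h j x (fun j' => f j' y x))
    (F : Fin l → ℕ → X → (Fin l → ℕ) → ℕ)
    (hF0 : ∀ (j : Fin l) (x : X) (a : Fin l → ℕ), F j 0 x a = h j x a)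
    (hFs : ∀ (j : Fin l) (y i : ℕ) (x : X) (a : Fin l → ℕ), i ≤ 1 → 2 * y + i ≠ 0 →
      F j (2 * y + i) x a = F j y x (fun j' => F j' y x a)) :
    ∀ (j : Fin l) (y : ℕ) (x : X),
      F j y x (fun j' => g j' x) = f j (2 ^ 2 ^ Nat.size y - 1) x := by
  have step (j : Fin l) (n : ℕ) (x : X) :
      f j (2 ^ (n + 1) - 1) x = h j x (fun j' => f j' (2 ^ n - 1) x) := by
    have hn : 2 ^ (n + 1) - 1 = 2 * (2 ^ n - 1) + 1 := by
      have := Nat.one_le_two_pow (n := n)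
      rw [pow_succ]
      omega
    rw [hn, hfs j _ 1 x le_rfl (by omega)]
  have key (y : ℕ) : ∀ (j : Fin l) (x : X) (n : ℕ),
      F j y x (fun j' => f j' (2 ^ n - 1) x) = f j (2 ^ (n + 2 ^ Nat.size y) - 1) x := by
    induction y using Nat.strong_induction_on with
    | _ y ih =>
      intro j x n
      rcases Nat.eq_zero_or_pos y with rfl | hy
      · simp only [hF0, Nat.size_zero, pow_zero, step]
      · have hdiv : 2 * (y / 2) + y % 2 = y := Nat.div_add_mod y 2
        have hlt : y / 2 < y := by omega
        have hsize : Nat.size y = Nat.size (y / 2) + 1 := by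
          have hbit : Nat.bit y.bodd y.div2 = y := Nat.bit_bodd_div2 y
          have hs := Nat.size_bit (b := y.bodd) (n := y.div2) (by omega)
          rwa [hbit, Nat.div2_val] at hs
        have hrec := hFs j (y / 2) (y % 2) x (fun j' => f j' (2 ^ n - 1) x)
          (by omega) (by omega)
        rw [hdiv] at hrec
        simp only [hrec, ih _ hlt]
        rw [hsize, pow_succ, mul_two, add_assoc]
  intro j y x
  simpa [hf0] using key y j x 0
end
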